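/- Let F : E → E be differentiable with ρ-Lipschitz derivative, and let M > 0. Suppose w, z, z½, z⁺ ∈ E satisfy z½ ≠ z, the implicit lazy cubic step F(z) + ∇F(w)(z½ − z) + M‖z½ − z‖·(z½ − z) = 0, and the extragradient step z⁺ = z − γ^{−1}·F(z½), where γ := M‖z½ − z‖. Then ‖z½ − z⁺‖ ≤ (ρ/(2M))·‖z½ − z‖ + (ρ/M)·‖w − z‖. -/

import Mathlib

open RealInnerProductSpace

/-- Second-order Taylor bound for a map whose derivative is `ρ`-Lipschitz. -/
theorem norm_sub_sub_fderiv_le_of_lipschitz_fderiv {E G : Type*} [NormedAddCommGroup E]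
    [NormedSpace ℝ E] [NormedAddCommGroup G] [NormedSpace ℝ G]
    {F : E → G} {ρ : ℝ} (hF : Differentiable ℝ F)
    (hlip : ∀ z z' : E, ‖fderiv ℝ F z - fderiv ℝ F z'‖ ≤ ρ * ‖z - z'‖) (z d : E) :
    ‖F (z + d) - F z - fderiv ℝ F z d‖ ≤ ρ / 2 * ‖d‖ ^ 2 := by
  let f : ℝ → G := fun t => F (z + t • d) - F z - t • fderiv ℝ F z d
  have hf : ∀ t, HasDerivAt f (fderiv ℝ F (z + t • d) d - fderiv ℝ F z d) t := by
    intro t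
    have hline : HasDerivAt (fun t : ℝ => z + t • d) d t := by
      simpa using ((hasDerivAt_id t).smul_const d).const_add z
    have hlin : HasDerivAt (fun t : ℝ => t • fderiv ℝ F z d) (fderiv ℝ F z d) t := by
      simpa using (hasDerivAt_id t).smul_const (fderiv ℝ F z d)
    exact (((hF _).hasFDerivAt.comp_hasDerivAt t hline).sub_const (F z)).sub hlin
  have hB : ∀ t : ℝ, HasDerivAt (fun t : ℝ => ρ / 2 * ‖d‖ ^ 2 * t ^ 2) (ρ * ‖d‖ ^ 2 * t) t := by
    intro t
    refine ((hasDerivAt_pow 2 t).const_mul (ρ / 2 * ‖d‖ ^ 2)).congr_deriv ?_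
    push_cast
    ring
  have key := image_norm_le_of_norm_deriv_right_le_deriv_boundary (f := f) (a := 0) (b := 1)
    (fun t _ => (hf t).continuousAt.continuousWithinAt)
    (fun t _ => (hf t).hasDerivWithinAt) (by simp [f]) hB
    (fun t ht => by
      calc ‖fderiv ℝ F (z + t • d) d - fderiv ℝ F z d‖
          = ‖(fderiv ℝ F (z + t • d) - fderiv ℝ F z) d‖ := by simp
        _ ≤ ‖fderiv ℝ F (z + t • d) - fderiv ℝ F z‖ * ‖d‖ := ContinuousLinearMap.le_opNorm _ _
        _ ≤ ρ * ‖z + t • d - z‖ * ‖d‖ := by gcongr; exact hlip _ _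
        _ = ρ * ‖d‖ ^ 2 * t := by
          rw [add_sub_cancel_left, norm_smul, Real.norm_of_nonneg ht.1]
          ring)
    (Set.right_mem_Icc.mpr zero_le_one)
  simpa [f] using key

/-- Error bound between the half-iterate and the extragradient iterate of LEN:
for differentiable `F` with `ρ`-Lipschitz derivative, if `z½` solves the implicit
lazy cubic step at snapshot `w` and `z⁺` is the extragradient step with
`γ = M‖z½ − z‖`, then `‖z½ − z⁺‖ ≤ (ρ/(2M))‖z½ − z‖ + (ρ/M)‖w − z‖`. -/
theorem len_half_step_error_bound {E : Type*} [NormedAddCommGroup E]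
    [InnerProductSpace ℝ E] [FiniteDimensional ℝ E]
    (F : E → E) (ρ M : ℝ) (hM : 0 < M)
    (hF : Differentiable ℝ F)
    (hlip : ∀ z z' : E, ‖fderiv ℝ F z - fderiv ℝ F z'‖ ≤ ρ * ‖z - z'‖)
    (w z zh zp : E) (hne : zh ≠ z)
    (hstep : F z + (fderiv ℝ F w) (zh - z) + (M * ‖zh - z‖) • (zh - z) = 0)
    (hextra : zp = z - (M * ‖zh - z‖)⁻¹ • F zh) :
    ‖zh - zp‖ ≤ ρ / (2 * M) * ‖zh - z‖ + ρ / M * ‖w - z‖ := by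
  have hd : 0 < ‖zh - z‖ := norm_pos_iff.mpr (sub_ne_zero.mpr hne)
  have hγ : 0 < M * ‖zh - z‖ := mul_pos hM hd
  have hdiff : zh - zp = (M * ‖zh - z‖)⁻¹ •
      ((F zh - F z - fderiv ℝ F z (zh - z)) + (fderiv ℝ F z - fderiv ℝ F w) (zh - z)) := by
    have hcubic : (M * ‖zh - z‖) • (zh - z) = -(F z + fderiv ℝ F w (zh - z)) :=
      eq_neg_of_add_eq_zero_right hstep
    have hsum : (F zh - F z - fderiv ℝ F z (zh - z)) + (fderiv ℝ F z - fderiv ℝ F w) (zh - z)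
        = F zh + (M * ‖zh - z‖) • (zh - z) := by
      rw [hcubic, sub_apply]
      abel
    rw [hsum, smul_add, inv_smul_smul₀ hγ.ne', hextra]
    abel
  have htaylor := norm_sub_sub_fderiv_le_of_lipschitz_fderiv hF hlip z (zh - z)
  rw [add_sub_cancel] at htaylor
  have hlazy : ‖(fderiv ℝ F z - fderiv ℝ F w) (zh - z)‖ ≤ ρ * ‖w - z‖ * ‖zh - z‖ := by
    rw [norm_sub_rev w z]
    exact ContinuousLinearMap.le_of_opNorm_le _ (hlip z w) _
  calc ‖zh - zp‖
      ≤ (M * ‖zh - z‖)⁻¹ * (ρ / 2 * ‖zh - z‖ ^ 2 + ρ * ‖w - z‖ * ‖zh - z‖) := by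
        rw [hdiff, norm_smul, Real.norm_of_nonneg (inv_nonneg.mpr hγ.le)]
        gcongr
        exact norm_add_le_of_le htaylor hlazy
    _ = ρ / (2 * M) * ‖zh - z‖ + ρ / M * ‖w - z‖ := by
        field_simp
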